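/- Let m be a universal semimeasure. Every lower semicomputable independence test is bounded by a constant: if f : List Bool × List Bool → ℝ≥0∞ is lower semicomputable and satisfies ∑' over pairs (x,y), m(x)·m(y)·f(x,y) ≤ 1, then there exists a constant C such that f(x,y) ≤ C for all pairs (x,y). -/

import Mathlib

open scoped ENNReal NNReal

/-- Interpret a rational approximation value as an extended nonnegative real. -/
noncomputable def qval (q : ℚ) : ℝ≥0∞ := ENNReal.ofReal q

/-- Interpret a value in `ℚ≥0 ∪ {∞}` (with nonnegativity required separately)
as an extended nonnegative real; `none` stands for `∞`. -/
noncomputable def qtval (q : Option ℚ) : ℝ≥0∞ := q.elim ⊤ (fun a => ENNReal.ofReal a)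

/-- A (discrete) semimeasure on bitstrings. -/
def IsSemimeasure (P : List Bool → ℝ≥0∞) : Prop := ∑' x, P x ≤ 1

/-- `Ps` is a computable approximation of `P` from below (by nonnegative rationals,
nondecreasing in the stage). -/
def IsApproxFromBelow (P : List Bool → ℝ≥0∞) (Ps : List Bool → ℕ → ℚ) : Prop :=
  Computable (fun p : List Bool × ℕ => Ps p.1 p.2) ∧
  (∀ x s, 0 ≤ Ps x s) ∧
  (∀ x, Monotone fun s => Ps x s) ∧
  (∀ x, P x = ⨆ s, qval (Ps x s))

/-- `P` is lower semicomputable. -/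
def LowerSemicomputable (P : List Bool → ℝ≥0∞) : Prop := ∃ Ps, IsApproxFromBelow P Ps

/-- `es` is a computable approximation of `e` from above (by values in `ℚ≥0 ∪ {∞}`,
nonincreasing in the stage). -/
def IsApproxFromAbove (e : List Bool → ℝ≥0∞) (es : List Bool → ℕ → Option ℚ) : Prop :=
  Computable (fun p : List Bool × ℕ => es p.1 p.2) ∧
  (∀ x s, ∀ a ∈ es x s, (0:ℚ) ≤ a) ∧
  (∀ x, Antitone fun s => qtval (es x s)) ∧
  (∀ x, e x = ⨅ s, qtval (es x s))

/-- `e` is upper semicomputable. -/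
def UpperSemicomputable (e : List Bool → ℝ≥0∞) : Prop := ∃ es, IsApproxFromAbove e es

/-- `e` is a sumtest for the semimeasure `P`. -/
def IsSumtest (P e : List Bool → ℝ≥0∞) : Prop := ∑' x, P x * e x ≤ 1

/-- `m` is a universal (lower semicomputable) semimeasure. -/
def IsUniversalSemimeasure (m : List Bool → ℝ≥0∞) : Prop :=
  IsSemimeasure m ∧ LowerSemicomputable m ∧
  ∀ P, IsSemimeasure P → LowerSemicomputable P → ∃ c : ℝ≥0, 0 < c ∧ ∀ x, P x ≤ c * m x

/-- A conditional semimeasure `m(·|·)`. -/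
def IsCondSemimeasure (m : List Bool → ℕ → ℝ≥0∞) : Prop := ∀ s, ∑' x, m x s ≤ 1

/-- `ms` is a computable approximation from below of the conditional semimeasure `m`:
`ms t x s` approximates `m(x|s)`, nondecreasing in the stage `t`. -/
def IsCondApproxFromBelow (m : List Bool → ℕ → ℝ≥0∞) (ms : ℕ → List Bool → ℕ → ℚ) : Prop :=
  Computable (fun p : ℕ × List Bool × ℕ => ms p.1 p.2.1 p.2.2) ∧
  (∀ t x s, 0 ≤ ms t x s) ∧
  (∀ x s, Monotone fun t => ms t x s) ∧
  (∀ x s, m x s = ⨆ t, qval (ms t x s))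

/-- The conditional semimeasure `m` is lower semicomputable (jointly). -/
def CondLowerSemicomputable (m : List Bool → ℕ → ℝ≥0∞) : Prop :=
  ∃ ms, IsCondApproxFromBelow m ms

/-- `m(·|·)` is a universal lower semicomputable conditional semimeasure. -/
def IsUniversalCondSemimeasure (m : List Bool → ℕ → ℝ≥0∞) : Prop :=
  IsCondSemimeasure m ∧ CondLowerSemicomputable m ∧
  ∀ m', IsCondSemimeasure m' → CondLowerSemicomputable m' →
    ∃ c : ℝ≥0, 0 < c ∧ ∀ x s, m' x s ≤ c * m x s

/-- A function on pairs of bitstrings is lower semicomputable if it has a computable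
approximation from below, jointly in the pair and the stage. -/
def LowerSemicomputablePair (f : List Bool × List Bool → ℝ≥0∞) : Prop :=
  ∃ fs : List Bool × List Bool → ℕ → ℚ,
    Computable (fun p : (List Bool × List Bool) × ℕ => fs p.1 p.2) ∧
    (∀ p s, 0 ≤ fs p s) ∧
    (∀ p, Monotone fun s => fs p s) ∧
    (∀ p, f p = ⨆ s, qval (fs p s))

theorem Nat.Subtype.computable_ofNat (s : Set ℕ) [DecidablePred (· ∈ s)] [Infinite s]
    (hs : ComputablePred (· ∈ s)) : Computable fun n => (Nat.Subtype.ofNat s n : ℕ) := by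
  have hex (x : ℕ) : ∃ n, x + n + 1 ∈ s := by
    obtain ⟨y, hy, hxy⟩ := (Set.infinite_coe_iff.1 ‹Infinite s›).exists_gt x
    exact ⟨y - x - 1, by rwa [show x + (y - x - 1) + 1 = y by omega]⟩
  have hfind : Computable fun x => Nat.find (hex x) := by
    refine Computable.find (Computable.computablePred ?_) hex
    exact hs.decide.comp (Computable.succ.comp (Primrec.nat_add.to_comp.comp .fst .snd))
  have hnext : Computable fun x => x + Nat.find (hex x) + 1 :=
    Computable.succ.comp (Primrec.nat_add.to_comp.comp .id hfind)
  refine (Computable.nat_rec (f := fun n : ℕ => n)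
    (g := fun _ => ((Nat.Subtype.ofNat s 0 : s) : ℕ))
    (h := fun _ p => p.2 + Nat.find (hex p.2) + 1) .id (.const _)
    (hnext.comp (Computable.snd.comp .snd)).to₂).of_eq fun n => ?_
  induction n with
  | zero => rfl
  | succ n ih => simp only at ih ⊢; rw [ih]; rfl

theorem Equiv.intEquivNat_natCast (a : ℕ) : Equiv.intEquivNat a = 2 * a :=
  Nat.bit_false_apply a

theorem Equiv.intEquivNat_negSucc (a : ℕ) :
    Equiv.intEquivNat (Int.negSucc a) = 2 * a + 1 :=
  Nat.bit_true_apply a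

theorem Int.natAbs_intEquivNat_symm (n : ℕ) :
    (Equiv.intEquivNat.symm n).natAbs = (n + 1) / 2 := by
  obtain ⟨z, rfl⟩ := Equiv.intEquivNat.surjective n
  rw [Equiv.symm_apply_apply]
  cases z with
  | ofNat a => rw [Int.ofNat_eq_natCast, Equiv.intEquivNat_natCast]; omega
  | negSucc a => rw [Equiv.intEquivNat_negSucc]; omega

namespace Rat

/-- The pair code of the numerator and denominator of a rational. -/
def pairCode (q : ℚ) : ℕ := Nat.pair (Encodable.encode q.num) q.den

theorem pairCode_injective : Function.Injective pairCode :=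
  @Encodable.encode_injective ℚ Rat.instEncodable

theorem mem_range_pairCode (n : ℕ) : n ∈ Set.range pairCode ↔
    n.unpair.2 ≠ 0 ∧ ∀ d < n.unpair.2 + 1, ¬ (d ≠ 1 ∧ n.unpair.2 % d = 0 ∧
      ((n.unpair.1 + 1) / 2) % d = 0) := by
  have hcop : n.unpair.2 ≠ 0 → ((∀ d < n.unpair.2 + 1, ¬ (d ≠ 1 ∧ n.unpair.2 % d = 0 ∧
      ((n.unpair.1 + 1) / 2) % d = 0)) ↔
        (Equiv.intEquivNat.symm n.unpair.1).natAbs.Coprime n.unpair.2) := by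
    intro h0
    rw [Int.natAbs_intEquivNat_symm]
    constructor
    · intro h
      by_contra hd
      exact h _ (Nat.lt_succ_of_le (Nat.gcd_le_right _ (Nat.pos_of_ne_zero h0)))
        ⟨hd, Nat.mod_eq_zero_of_dvd (Nat.gcd_dvd_right _ _),
          Nat.mod_eq_zero_of_dvd (Nat.gcd_dvd_left _ _)⟩
    · rintro h d - ⟨hd, h1, h2⟩
      exact hd (Nat.eq_one_of_dvd_coprimes h (Nat.dvd_of_mod_eq_zero h2)
        (Nat.dvd_of_mod_eq_zero h1))
  constructor
  · rintro ⟨q, rfl⟩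
    have h0 : (pairCode q).unpair.2 ≠ 0 := by simp [pairCode]
    refine ⟨h0, (hcop h0).2 ?_⟩
    simp only [pairCode, Nat.unpair_pair]
    have : Equiv.intEquivNat.symm (Encodable.encode q.num) = q.num :=
      Equiv.intEquivNat.symm_apply_apply _
    rw [this]
    exact q.reduced
  · rintro ⟨h0, h⟩
    refine ⟨⟨Equiv.intEquivNat.symm n.unpair.1, n.unpair.2, h0, (hcop h0).1 h⟩, ?_⟩
    have : Encodable.encode (Equiv.intEquivNat.symm n.unpair.1) = n.unpair.1 :=
      Equiv.intEquivNat.apply_symm_apply _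
    simp [pairCode, this]

theorem primrecPred_mem_range_pairCode : PrimrecPred (· ∈ Set.range pairCode) := by
  have hden : Primrec fun n : ℕ => n.unpair.2 := Primrec.snd.comp Primrec.unpair
  have hnum : Primrec fun n : ℕ => (n.unpair.1 + 1) / 2 :=
    Primrec.nat_div.comp (Primrec.succ.comp (Primrec.fst.comp Primrec.unpair)) (.const 2)
  have hrel : PrimrecRel fun d n : ℕ => ¬ (d ≠ 1 ∧ n.unpair.2 % d = 0 ∧
      ((n.unpair.1 + 1) / 2) % d = 0) := by
    refine PrimrecRel.not ?_
    exact (Primrec.eq.comp .fst (.const 1)).not.and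
      ((Primrec.eq.comp (Primrec.nat_mod.comp (hden.comp .snd) .fst) (.const 0)).and
        (Primrec.eq.comp (Primrec.nat_mod.comp (hnum.comp .snd) .fst) (.const 0)))
  exact ((Primrec.eq.comp hden (.const 0)).not.and
    (hrel.forall_lt.comp (Primrec.succ.comp hden) .id)).of_eq fun n => (mem_range_pairCode n).symm

theorem computable_pairCode : Computable pairCode := by
  let _ := @Encodable.decidableRangeEncode ℚ Rat.instEncodable
  have : Infinite (Set.range (@Encodable.encode ℚ Rat.instEncodable)) :=
    (Set.infinite_range_of_injective pairCode_injective).to_subtype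
  have h := Nat.Subtype.computable_ofNat (Set.range (@Encodable.encode ℚ Rat.instEncodable))
    primrecPred_mem_range_pairCode.computablePred
  refine (h.comp (Computable.encode (α := ℚ))).of_eq fun q => ?_
  have key : Nat.Subtype.ofNat (Set.range (@Encodable.encode ℚ Rat.instEncodable))
      (@Encodable.encode ℚ Rat.instDenumerable.toEncodable q) =
        @Encodable.equivRangeEncode ℚ Rat.instEncodable q := by
    let _ := Nat.Subtype.denumerable (Set.range (@Encodable.encode ℚ Rat.instEncodable))
    exact Denumerable.ofNat_encode (@Encodable.equivRangeEncode ℚ Rat.instEncodable q)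
  rw [key]
  rfl

theorem computable_of_pairCode {α : Type*} [Primcodable α] {f : α → ℚ}
    (hf : Computable fun a => (f a).pairCode) : Computable f := by
  have hex (a : α) : ∃ n, (Denumerable.ofNat ℚ n).pairCode = (f a).pairCode :=
    ⟨@Encodable.encode ℚ Rat.instDenumerable.toEncodable (f a), by rw [Denumerable.ofNat_encode]⟩
  have hfind : Computable fun a => Nat.find (hex a) := by
    refine Computable.find (Computable.computablePred ?_) hex
    exact Primrec.eq.decide.to_comp.comp
      (computable_pairCode.comp ((Computable.ofNat ℚ).comp .snd)) (hf.comp .fst)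
  exact ((Computable.ofNat ℚ).comp hfind).of_eq fun a =>
    pairCode_injective (Nat.find_spec (hex a))

theorem computable_one_div_two_pow : Computable fun n : ℕ => (1 / 2 ^ (n + 1) : ℚ) := by
  apply computable_of_pairCode
  have h (n : ℕ) : (1 / 2 ^ (n + 1) : ℚ).pairCode
      = Nat.pair (Encodable.encode (1 : ℤ)) (2 ^ (n + 1)) := by
    have : (1 / 2 ^ (n + 1) : ℚ) = ((2 ^ (n + 1) : ℕ) : ℚ)⁻¹ := by push_cast; ring
    rw [this, pairCode, Rat.inv_natCast_num_of_pos (by positivity),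
      Rat.inv_natCast_den_of_pos (by positivity)]
  have hpow : Primrec fun n : ℕ => 2 ^ (n + 1) :=
    (Primrec₂.unpaired'.1 Nat.Primrec.pow).comp (.const 2) Primrec.succ
  exact ((Primrec₂.natPair.comp (.const _) hpow).to_comp).of_eq fun n => (h n).symm

theorem natCast_lt_iff_pairCode (k : ℕ) (q : ℚ) : (k : ℚ) < q ↔
    q.pairCode.unpair.1 % 2 = 0 ∧
      k * q.pairCode.unpair.2 < q.pairCode.unpair.1 / 2 := by
  have henc : Encodable.encode q.num = Equiv.intEquivNat q.num := rfl
  have hlt : (k : ℚ) < q ↔ (k : ℤ) * q.den < q.num := by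
    rw [Rat.lt_iff]; simp
  rw [hlt]
  simp only [pairCode, Nat.unpair_pair, henc]
  cases q.num with
  | ofNat a =>
    rw [Int.ofNat_eq_natCast, Equiv.intEquivNat_natCast, show 2 * a % 2 = 0 by omega,
      show 2 * a / 2 = a by omega]
    norm_cast
    simp
  | negSucc a =>
    rw [Equiv.intEquivNat_negSucc]
    have h0 : (0 : ℤ) ≤ (k : ℤ) * q.den := by positivity
    constructor
    · intro h
      have := Int.negSucc_lt_zero a
      omega
    · rintro ⟨h, -⟩
      omega

theorem computablePred_natCast_lt : ComputablePred fun p : ℕ × ℚ => (p.1 : ℚ) < p.2 := by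
  have hrel : PrimrecPred fun p : ℕ × ℕ => p.2.unpair.1 % 2 = 0 ∧
      p.1 * p.2.unpair.2 < p.2.unpair.1 / 2 := by
    have hu : Primrec fun p : ℕ × ℕ => p.2.unpair := Primrec.unpair.comp .snd
    exact (Primrec.eq.comp (Primrec.nat_mod.comp (Primrec.fst.comp hu) (.const 2)) (.const 0)).and
      (Primrec.nat_lt.comp (Primrec.nat_mul.comp .fst (Primrec.snd.comp hu))
        (Primrec.nat_div.comp (Primrec.fst.comp hu) (.const 2)))
  have := hrel.computablePred.decide.comp
    (Computable.pair (α := ℕ × ℚ) .fst (computable_pairCode.comp .snd))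
  exact Computable.computablePred (this.of_eq fun p => by
    simp only [natCast_lt_iff_pairCode])

end Rat

/-- The least index below `s` at which the sequence `h` takes the value `x`, if there is one. -/
def firstIndexBelow {α : Type*} [DecidableEq α] (h : ℕ → α) (x : α) (s : ℕ) : Option ℕ :=
  Nat.rec none (fun t o => o.casesOn (if h t = x then some t else none) some) s

section firstIndexBelow

variable {α : Type*} [DecidableEq α] (h : ℕ → α) (x : α)

theorem firstIndexBelow_succ (s : ℕ) : firstIndexBelow h x (s + 1) =
    (firstIndexBelow h x s).casesOn (if h s = x then some s else none) some := rfl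

theorem firstIndexBelow_eq_some {s n : ℕ} (hn : firstIndexBelow h x s = some n) : h n = x := by
  induction s with
  | zero => simp [firstIndexBelow] at hn
  | succ s ih =>
    rw [firstIndexBelow_succ] at hn
    cases ho : firstIndexBelow h x s with
    | some k => rw [ho] at hn; exact ih (ho.trans hn)
    | none =>
      rw [ho] at hn
      by_cases hs : h s = x <;> simp_all

theorem exists_firstIndexBelow (n : ℕ) : ∃ k ≤ n, firstIndexBelow h (h n) (n + 1) = some k := by
  have hle (s k : ℕ) (hk : firstIndexBelow h (h n) s = some k) : k < s := by
    induction s with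
    | zero => simp [firstIndexBelow] at hk
    | succ s ih =>
      rw [firstIndexBelow_succ] at hk
      cases ho : firstIndexBelow h (h n) s with
      | some j => rw [ho] at hk; exact (ih (ho.trans hk)).trans (Nat.lt_succ_self s)
      | none =>
        rw [ho] at hk
        by_cases hs : h s = h n <;> simp_all
  rw [firstIndexBelow_succ]
  cases ho : firstIndexBelow h (h n) n with
  | some k => exact ⟨k, (hle n k ho).le, rfl⟩
  | none => exact ⟨n, le_rfl, by simp⟩

theorem computable_firstIndexBelow {β : Type*} [Primcodable β] [DecidableEq β] {h : ℕ → β}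
    (hh : Computable h) : Computable fun p : β × ℕ => firstIndexBelow h p.1 p.2 := by
  refine Computable.nat_rec (f := fun p : β × ℕ => p.2) (g := fun _ => none)
    (h := fun p q => q.2.casesOn (if h q.1 = p.1 then some q.1 else none) some)
    .snd (.const _) ?_
  have hcase : Computable fun a : (β × ℕ) × ℕ × Option ℕ =>
      if h a.2.1 = a.1.1 then some a.2.1 else none := by
    refine (Computable.cond (c := fun a : (β × ℕ) × ℕ × Option ℕ => decide (h a.2.1 = a.1.1))
      (Primrec.eq.decide.to_comp.comp (hh.comp (Computable.fst.comp .snd))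
        (Computable.fst.comp .fst))
      (Computable.option_some.comp (Computable.fst.comp .snd)) (.const none)).of_eq fun a => ?_
    by_cases ha : h a.2.1 = a.1.1 <;> simp [ha]
  have hstep := Computable.option_casesOn (o := fun a : (β × ℕ) × ℕ × Option ℕ => a.2.2)
    (g := fun _ n => some n) (Computable.snd.comp .snd) hcase
    (Computable.option_some.comp .snd).to₂
  exact hstep.to₂

end firstIndexBelow

theorem qval_one_div_two_pow (n : ℕ) : qval (1 / 2 ^ (n + 1)) = (2⁻¹ : ℝ≥0∞) ^ (n + 1) := by
  rw [qval]
  push_cast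
  rw [one_div, ← inv_pow, ENNReal.ofReal_pow (by norm_num), ENNReal.ofReal_inv_of_pos (by norm_num)]
  norm_num

/-- A universal semimeasure gives the `n`-th term of a computable sequence weight at least
a constant times `2⁻ⁿ`. -/
theorem IsUniversalSemimeasure.exists_pow_le_mul_of_computable {m : List Bool → ℝ≥0∞}
    (hm : IsUniversalSemimeasure m) {h : ℕ → List Bool} (hh : Computable h) :
    ∃ c : ℝ≥0, ∀ n, (2⁻¹ : ℝ≥0∞) ^ (n + 1) ≤ c * m (h n) := by
  set Ps : List Bool → ℕ → ℚ := fun x s =>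
    (firstIndexBelow h x s).elim 0 fun n => 1 / 2 ^ (n + 1) with hPs
  set P : List Bool → ℝ≥0∞ := fun x => ⨆ s, qval (Ps x s) with hP
  have hnonneg x s : 0 ≤ Ps x s := by
    simp only [hPs]
    cases firstIndexBelow h x s <;> simp
  have hcomp : Computable fun p : List Bool × ℕ => Ps p.1 p.2 := by
    refine (Computable.option_casesOn (computable_firstIndexBelow hh) (.const 0)
      (Rat.computable_one_div_two_pow.comp .snd).to₂).of_eq fun p => ?_
    simp only [hPs]
    cases firstIndexBelow h p.1 p.2 <;> rfl
  have hmono x : Monotone fun s => Ps x s := by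
    refine monotone_nat_of_le_succ fun s => ?_
    cases ho : firstIndexBelow h x s with
    | none => simpa [hPs, ho] using hnonneg x (s + 1)
    | some k => simp [hPs, firstIndexBelow_succ, ho]
  have hsemi : IsSemimeasure P := by
    have hle x : P x ≤ ∑' n, if h n = x then (2⁻¹ : ℝ≥0∞) ^ (n + 1) else 0 := by
      refine iSup_le fun s => ?_
      cases ho : firstIndexBelow h x s with
      | none => simp [hPs, ho, qval]
      | some k =>
        refine le_trans ?_ (ENNReal.le_tsum k)
        simp only [hPs, ho, Option.elim, firstIndexBelow_eq_some h x ho, if_true]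
        rw [qval_one_div_two_pow]
    calc ∑' x, P x ≤ ∑' x, ∑' n, if h n = x then (2⁻¹ : ℝ≥0∞) ^ (n + 1) else 0 :=
          ENNReal.tsum_le_tsum hle
      _ = ∑' n, ∑' x, if h n = x then (2⁻¹ : ℝ≥0∞) ^ (n + 1) else 0 := ENNReal.tsum_comm
      _ = ∑' n : ℕ, (2⁻¹ : ℝ≥0∞) ^ (n + 1) := by simp only [tsum_ite_eq']
      _ ≤ 1 := by
        rw [ENNReal.tsum_geometric_add_one, ENNReal.one_sub_inv_two, inv_inv,
          ENNReal.inv_mul_cancel two_ne_zero ENNReal.ofNat_ne_top]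
  obtain ⟨c, -, hc⟩ := hm.2.2 P hsemi ⟨Ps, hcomp, hnonneg, hmono, fun _ => rfl⟩
  refine ⟨c, fun n => le_trans ?_ (hc (h n))⟩
  obtain ⟨k, hkn, hk⟩ := exists_firstIndexBelow h n
  refine le_trans ?_ (le_iSup (fun s => qval (Ps (h n) s)) (n + 1))
  simp only [hPs, hk, Option.elim]
  rw [qval_one_div_two_pow]
  exact pow_le_pow_right_of_le_one' (by simp) (by omega)

/-- An unbounded lower semicomputable function on pairs takes large values along a
computable sequence. -/
theorem LowerSemicomputablePair.exists_computable_seq {f : List Bool × List Bool → ℝ≥0∞}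
    (hf : LowerSemicomputablePair f) (hunb : ∀ C : ℝ≥0, ∃ p, (C : ℝ≥0∞) < f p)
    {K : ℕ → ℕ} (hK : Computable K) :
    ∃ g : ℕ → List Bool × List Bool, Computable g ∧ ∀ n, (K n : ℝ≥0∞) ≤ f (g n) := by
  obtain ⟨fs, hcomp, -, -, hsup⟩ := hf
  set v : Option ((List Bool × List Bool) × ℕ) → ℚ :=
    fun o => o.elim 0 fun p => fs p.1 p.2 with hv
  have hvcomp : Computable v := by
    refine (Computable.option_casesOn .id (.const 0) (hcomp.comp .snd).to₂).of_eq fun o => ?_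
    cases o <;> rfl
  have hex (n : ℕ) : ∃ k, (K n : ℚ) <
      v (Encodable.decode (α := (List Bool × List Bool) × ℕ) k) := by
    obtain ⟨p, hp⟩ := hunb (K n)
    rw [hsup, lt_iSup_iff] at hp
    obtain ⟨s, hs⟩ := hp
    refine ⟨Encodable.encode (p, s), ?_⟩
    simp only [Encodable.encodek, hv, Option.elim]
    rw [qval, ENNReal.coe_natCast, ENNReal.natCast_lt_ofReal] at hs
    exact_mod_cast hs
  have hfind : Computable fun n => Nat.find (hex n) := by
    have hpair : Computable fun p : ℕ × ℕ =>
        (K p.1, v (Encodable.decode (α := (List Bool × List Bool) × ℕ) p.2)) :=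
      (hK.comp .fst).pair (hvcomp.comp (Computable.decode.comp .snd))
    exact Computable.find (Rat.computablePred_natCast_lt.decide.comp hpair).computablePred hex
  refine ⟨fun n => ((Encodable.decode (α := (List Bool × List Bool) × ℕ)
    (Nat.find (hex n))).getD (([], []), 0)).1, Computable.fst.comp
      ((Computable.option_getD (Computable.decode.comp hfind) (.const _))), fun n => ?_⟩
  have hn := Nat.find_spec (hex n)
  cases ho : Encodable.decode (α := (List Bool × List Bool) × ℕ) (Nat.find (hex n)) with
  | none =>
    rw [ho] at hn
    exact absurd hn (by simp [hv])
  | some p =>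
    rw [ho] at hn
    simp only [hv, Option.elim] at hn
    simp only [ho, Option.getD_some]
    rw [hsup]
    refine le_trans ?_ (le_iSup _ p.2)
    rw [qval, ← ENNReal.ofReal_natCast]
    refine ENNReal.ofReal_le_ofReal ?_
    exact_mod_cast hn.le

/-- Every lower semicomputable independence test (sumtest for `(x,y) ↦ m(x)·m(y)`)
is bounded by a constant. -/
theorem lower_semicomputable_independence_test_bounded
    (m : List Bool → ℝ≥0∞) (hm : IsUniversalSemimeasure m)
    (f : List Bool × List Bool → ℝ≥0∞) (hf : LowerSemicomputablePair f)
    (hsum : ∑' p : List Bool × List Bool, m p.1 * m p.2 * f p ≤ 1) :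
    ∃ C : ℝ≥0, ∀ p : List Bool × List Bool, f p ≤ (C : ℝ≥0∞) := by
  by_contra! hunb
  have hpow : Computable fun n : ℕ => 8 ^ (n + 1) :=
    ((Primrec₂.unpaired'.1 Nat.Primrec.pow).comp (.const 8) Primrec.succ).to_comp
  obtain ⟨g, hg, hgf⟩ := hf.exists_computable_seq hunb hpow
  obtain ⟨c, hc⟩ := hm.exists_pow_le_mul_of_computable (Computable.fst.comp hg)
  obtain ⟨d, hd⟩ := hm.exists_pow_le_mul_of_computable (Computable.snd.comp hg)
  have key (n : ℕ) : (2 : ℝ≥0∞) ^ (n + 1) ≤ c * d := by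
    calc (2 : ℝ≥0∞) ^ (n + 1) = 2⁻¹ ^ (n + 1) * 2⁻¹ ^ (n + 1) * ((8 ^ (n + 1) : ℕ) : ℝ≥0∞) := by
          push_cast
          rw [← mul_pow, ← mul_pow, show (8 : ℝ≥0∞) = 2 * (2 * 2) by norm_num,
            show (2⁻¹ : ℝ≥0∞) * 2⁻¹ * (2 * (2 * 2)) = (2⁻¹ * 2) * (2⁻¹ * 2) * 2 by ring,
            ENNReal.inv_mul_cancel two_ne_zero ENNReal.ofNat_ne_top, one_mul, one_mul]
      _ ≤ (c * m (g n).1) * (d * m (g n).2) * f (g n) := by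
          gcongr
          exacts [hc n, hd n, hgf n]
      _ = c * d * (m (g n).1 * m (g n).2 * f (g n)) := by ring
      _ ≤ c * d * 1 := by
          gcongr
          exact (ENNReal.le_tsum (g n)).trans hsum
      _ = c * d := mul_one _
  obtain ⟨n, hn⟩ := exists_nat_gt (c * d)
  have h := key n
  have hlt : n < 2 ^ (n + 1) := (Nat.lt_succ_self n).trans Nat.lt_two_pow_self
  have hle : ((2 : ℝ≥0) ^ (n + 1)) ≤ c * d := by exact_mod_cast h
  have hlt_pow : (n : ℝ≥0) < 2 ^ (n + 1) := by exact_mod_cast hlt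
  exact absurd (hn.trans hlt_pow) hle.not_gt
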